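/- Let d ≥ 5 be an integer, written as d = 5 + 4q + j with integers q ≥ 0 and 0 ≤ j ≤ 3. Then every (3;4,d)-cage, i.e., every 3-regular simple graph of girth exactly 4 and diameter exactly d with the minimum possible number n(3;4,d) = 14 + 2j + 6q of vertices, has at least q bridges. -/

import Mathlib

/-- A graph is `k`-regular: every vertex has exactly `k` neighbours. -/
def IsRegular' (k : ℕ) {V : Type*} (G : SimpleGraph V) : Prop :=
  ∀ v : V, (G.neighborSet v).ncard = k

/-- A `(k; g, d)`-graph: a `k`-regular simple graph of girth exactly `g` and
diameter exactly `d`. -/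
def IsKGDGraph (k g d : ℕ) {V : Type*} (G : SimpleGraph V) : Prop :=
  IsRegular' k G ∧ G.egirth = g ∧ G.ediam = d

namespace SimpleGraph

variable {V : Type*} {G : SimpleGraph V}

lemma Connected.exists_adj_dist_eq (hc : G.Connected) {u w : V} {i : ℕ}
    (hw : G.dist u w = i + 1) : ∃ x, G.Adj x w ∧ G.dist u x = i := by
  obtain ⟨p, hp⟩ := hc.exists_walk_length_eq_dist w u
  rw [dist_comm, hw] at hp
  cases p with
  | nil => simp at hp
  | @cons _ x _ h p =>
    have h1 : G.dist x u ≤ i := (dist_le p).trans (by simpa using hp.le)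
    have h2 := hc.dist_triangle (u := u) (v := x) (w := w)
    rw [dist_eq_one_iff_adj.2 h.symm] at h2
    rw [dist_comm] at h1
    exact ⟨x, h.symm, by omega⟩

lemma Connected.exists_dist_eq_of_le (hc : G.Connected) {u v : V} {i : ℕ}
    (hi : i ≤ G.dist u v) : ∃ x, G.dist u x = i := by
  induction hi using Nat.decreasingInduction with
  | self => exact ⟨v, rfl⟩
  | of_succ k _ ih =>
    obtain ⟨w, hw⟩ := ih
    obtain ⟨x, -, hx⟩ := hc.exists_adj_dist_eq hw
    exact ⟨x, hx⟩

lemma Connected.dist_le_dist_add_one (hc : G.Connected) (u : V) {x y : V} (h : G.Adj x y) :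
    G.dist u y ≤ G.dist u x + 1 := by
  simpa [dist_eq_one_iff_adj.2 h] using hc.dist_triangle (u := u) (v := x) (w := y)

/-- An edge that is the only one leaving a vertex set is a bridge. -/
lemma isBridge_of_unique_crossing {A : Set V} {a b : V} (ha : a ∈ A) (hb : b ∉ A)
    (h : ∀ x ∈ A, ∀ y ∉ A, G.Adj x y → x = a ∧ y = b) : G.IsBridge s(a, b) := by
  rw [isBridge_iff_forall_walk_mem_edges]
  intro p
  obtain ⟨e, he, h1, h2⟩ := p.exists_boundary_dart A ha hb
  obtain ⟨h3, h4⟩ := h _ h1 _ h2 e.adj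
  have hmem : s(e.fst, e.snd) ∈ p.edges := List.mem_map_of_mem he
  rwa [h3, h4] at hmem

lemma not_adj_of_four_le_egirth (hg : 4 ≤ G.egirth) {a b c : V} (hab : G.Adj a b)
    (hbc : G.Adj b c) : ¬ G.Adj c a := by
  intro hca
  have hcyc : (Walk.cons hab (Walk.cons hbc (Walk.cons hca Walk.nil))).IsCycle := by
    simp [Walk.cons_isCycle_iff, hab.ne, hab.ne', hbc.ne, hca.ne, hca.ne']
  have := hg.trans (egirth_le_length hcyc)
  norm_num at this

variable [Fintype V]

open Classical in
/-- In a connected triangle-free cubic graph, a vertex with some vertex at distance three has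
at least seven vertices within distance two. -/
lemma seven_le_card_dist_le_two (hc : G.Connected) (hr : G.IsRegularOfDegree 3)
    (hg : 4 ≤ G.egirth) {u v : V} (huv : 3 ≤ G.dist u v) :
    7 ≤ (Finset.univ.filter fun w => G.dist u w ≤ 2).card := by
  set S := Finset.univ.filter fun w => G.dist u w = 2 with hS
  have hsub : ∀ a, G.Adj u a → (G.neighborFinset a).erase u ⊆ S := by
    intro a ha w hw
    obtain ⟨hwu, haw⟩ : w ≠ u ∧ G.Adj a w := by simpa using hw
    have h1 := hc.dist_le_dist_add_one u haw
    rw [dist_eq_one_iff_adj.2 ha] at h1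
    have h2 := hc.one_lt_dist_of_ne_of_not_adj hwu.symm
      fun h => not_adj_of_four_le_egirth hg ha haw h.symm
    simp only [hS, Finset.mem_filter_univ]
    omega
  have hcard : ∀ a, G.Adj u a → ((G.neighborFinset a).erase u).card = 2 := by
    intro a ha
    rw [Finset.card_erase_of_mem (by simpa using ha.symm), card_neighborFinset_eq_degree, hr a]
  have hS3 : 3 ≤ S.card := by
    by_contra! hlt
    obtain ⟨w, hw⟩ := hc.exists_dist_eq_of_le huv
    obtain ⟨x, hxw, hx⟩ := hc.exists_adj_dist_eq hw
    have hN : G.neighborFinset u ⊆ G.neighborFinset x := by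
      intro a ha
      have ha : G.Adj u a := by simpa using ha
      have heq := Finset.eq_of_subset_of_card_le (hsub a ha) (by rw [hcard a ha]; omega)
      have hxS : x ∈ S := by simpa [hS] using hx
      rw [← heq] at hxS
      have : x ≠ u ∧ G.Adj a x := by simpa using hxS
      simpa using this.2.symm
    have heq := Finset.eq_of_subset_of_card_le hN (by simp [hr u, hr x])
    have : G.Adj u w := by
      have : w ∈ G.neighborFinset x := by simpa using hxw
      rw [← heq] at this
      simpa using this
    rw [dist_eq_one_iff_adj.2 this] at hw
    omega
  have hdisj : Disjoint (G.neighborFinset u) S := by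
    rw [Finset.disjoint_left]
    intro a ha haS
    have ha : G.dist u a = 1 := dist_eq_one_iff_adj.2 (by simpa using ha)
    have : G.dist u a = 2 := by simpa [hS] using haS
    omega
  have hu : u ∉ (G.neighborFinset u).disjUnion S hdisj := by simp [hS]
  calc 7 ≤ (insert u ((G.neighborFinset u).disjUnion S hdisj)).card := by
        rw [Finset.card_insert_of_notMem hu, Finset.card_disjUnion,
          card_neighborFinset_eq_degree, hr u]
        omega
    _ ≤ _ := by
        apply Finset.card_le_card
        intro w hw
        simp only [Finset.mem_insert, Finset.mem_disjUnion, mem_neighborFinset, hS,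
          Finset.mem_filter_univ] at hw ⊢
        rcases hw with rfl | hw | hw
        · simp
        · rw [dist_eq_one_iff_adj.2 hw]; omega
        · exact hw.le

open Classical in
/-- In a connected cubic graph, the vertex of a singleton level in the distance partition from
`u`, other than the first and the last level, is incident with a bridge. -/
lemma exists_isBridge_of_dist_unique (hc : G.Connected) (hr : G.IsRegularOfDegree 3)
    {u x z : V} (hx : 0 < G.dist u x) (hz : G.dist u x < G.dist u z)
    (huniq : ∀ y, G.dist u y = G.dist u x → y = x) : ∃ e, G.IsBridge e ∧ x ∈ e := by
  obtain ⟨i, hi⟩ : ∃ i, G.dist u x = i + 1 := ⟨G.dist u x - 1, by omega⟩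
  have hsplit : ∀ y, G.Adj x y → G.dist u y = i ∨ G.dist u y = i + 2 := by
    intro y hy
    have h1 := hc.dist_le_dist_add_one u hy
    have h2 := hc.dist_le_dist_add_one u hy.symm
    have h3 : G.dist u y ≠ i + 1 := fun h => hy.ne' (huniq y (h.trans hi.symm))
    omega
  set D := (G.neighborFinset x).filter fun y => G.dist u y = i with hD
  set U := (G.neighborFinset x).filter fun y => ¬ G.dist u y = i with hU
  have hDU : D.card + U.card = 3 := by
    rw [hD, hU, Finset.card_filter_add_card_filter_not, card_neighborFinset_eq_degree, hr x]
  have hDpos : 0 < D.card := by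
    obtain ⟨y, hy, hyi⟩ := hc.exists_adj_dist_eq hi
    exact Finset.card_pos.2 ⟨y, by simp [hD, hy.symm, hyi]⟩
  have hUpos : 0 < U.card := by
    obtain ⟨w, hw⟩ := hc.exists_dist_eq_of_le (i := i + 2) (u := u) (v := z) (by omega)
    obtain ⟨y, hy, hyi⟩ := hc.exists_adj_dist_eq hw
    obtain rfl := huniq y (hyi.trans hi.symm)
    exact Finset.card_pos.2 ⟨w, by simp [hU, hy, hw]⟩
  obtain h | h : D.card = 1 ∨ U.card = 1 := by omega
  · obtain ⟨b, hb⟩ := Finset.card_eq_one.1 h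
    have hbD : b ∈ D := by simp [hb]
    have hbi : G.dist u b = i := (Finset.mem_filter.1 hbD).2
    refine ⟨s(x, b), isBridge_of_unique_crossing (A := {w | i + 1 ≤ G.dist u w}) ?_ ?_ ?_,
      Sym2.mem_mk_left _ _⟩
    · simp [hi]
    · simp [hbi]
    · intro y hy w hw hyw
      simp only [Set.mem_ofPred_eq, not_le] at hy hw
      have h1 := hc.dist_le_dist_add_one u hyw.symm
      obtain rfl := huniq y (by omega)
      refine ⟨rfl, ?_⟩
      have : w ∈ D := by simpa [hD, hyw] using (by omega : G.dist u w = i)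
      simpa [hb] using this
  · obtain ⟨b, hb⟩ := Finset.card_eq_one.1 h
    have hbU : b ∈ U := by simp [hb]
    obtain ⟨hxb, hbi⟩ : G.Adj x b ∧ G.dist u b ≠ i := by simpa [hU] using hbU
    have hbi2 := (hsplit b hxb).resolve_left hbi
    refine ⟨s(x, b), isBridge_of_unique_crossing (A := {w | G.dist u w ≤ i + 1}) ?_ ?_ ?_,
      Sym2.mem_mk_left _ _⟩
    · simp [hi]
    · simp [hbi2]
    · intro y hy w hw hyw
      simp only [Set.mem_ofPred_eq, not_le] at hy hw
      have h1 := hc.dist_le_dist_add_one u hyw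
      obtain rfl := huniq y (by omega)
      refine ⟨rfl, ?_⟩
      have : w ∈ U := by simpa [hU, hyw] using (by omega : G.dist u w ≠ i)
      simpa [hb] using this

open Classical in
/-- If each vertex of `X` is incident with a bridge, there are at least `#X / 2` bridges. -/
lemma card_le_two_mul_ncard_isBridge {X : Finset V} (hX : ∀ x ∈ X, ∃ e, G.IsBridge e ∧ x ∈ e) :
    X.card ≤ 2 * {e : Sym2 V | G.IsBridge e}.ncard := by
  rw [Set.ncard_eq_toFinset_card']
  obtain rfl | ⟨x₀, -⟩ := X.eq_empty_or_nonempty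
  · simp
  have : Nonempty (Sym2 V) := ⟨s(x₀, x₀)⟩
  choose! f hf hmem using hX
  refine Finset.card_le_mul_card_image_of_maps_to (f := f) (fun x hx => by simpa using hf x hx) 2
    fun e _ => ?_
  calc _ ≤ e.toFinset.card := by
        apply Finset.card_le_card
        intro x hx
        obtain ⟨hxX, hxe⟩ := Finset.mem_filter.1 hx
        simpa [← hxe] using hmem x hxX
    _ ≤ 2 := by rw [Sym2.card_toFinset]; split_ifs <;> omega

open Classical in
/-- In a connected triangle-free cubic graph with vertices `u`, `v` at distance at least five, the interior
levels of the distance partition from `u` contain at most `|V| - 14` vertices in total. -/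
lemma sum_card_levels_add_le (hc : G.Connected) (hr : G.IsRegularOfDegree 3)
    (hg : 4 ≤ G.egirth) {u v : V} (huv : 5 ≤ G.dist u v) :
    ∑ i ∈ Finset.Icc 3 (G.dist u v - 3), (Finset.univ.filter fun w => G.dist u w = i).card + 14
      ≤ Fintype.card V := by
  have hA := seven_le_card_dist_le_two hc hr hg (u := u) (v := v) (by omega)
  have hB := seven_le_card_dist_le_two hc hr hg (u := v) (v := u) (by rw [dist_comm]; omega)
  set A := Finset.univ.filter fun w => G.dist u w ≤ 2 with hAdef
  set B := Finset.univ.filter fun w => G.dist v w ≤ 2 with hBdef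
  set M := Finset.univ.filter fun w => G.dist u w ∈ Finset.Icc 3 (G.dist u v - 3) with hMdef
  have hM : M.card = ∑ i ∈ Finset.Icc 3 (G.dist u v - 3),
      (Finset.univ.filter fun w => G.dist u w = i).card := by
    rw [Finset.card_eq_sum_card_fiberwise (f := G.dist u) (t := Finset.Icc 3 (G.dist u v - 3))
      (fun w hw => by simpa [hMdef] using hw)]
    refine Finset.sum_congr rfl fun i hi => ?_
    congr 1
    ext w
    simp only [hMdef, Finset.mem_filter, Finset.mem_univ, true_and, and_iff_right_iff_imp]
    rintro rfl
    exact hi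
  have hBfar : ∀ w ∈ B, G.dist u v ≤ G.dist u w + 2 := by
    intro w hw
    have h1 := hc.dist_triangle (u := u) (v := w) (w := v)
    have h2 : G.dist v w ≤ 2 := by simpa [hBdef] using hw
    rw [dist_comm] at h2
    omega
  have hAM : Disjoint A M := by
    rw [Finset.disjoint_left]
    intro w hw hw'
    simp only [hAdef, hMdef, Finset.mem_filter_univ, Finset.mem_Icc] at hw hw'
    omega
  have hAMB : Disjoint (A ∪ M) B := by
    rw [Finset.disjoint_left]
    intro w hw hw'
    have := hBfar w hw'
    simp only [hAdef, hMdef, Finset.mem_union, Finset.mem_filter_univ, Finset.mem_Icc] at hw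
    omega
  have := Finset.card_le_univ (A ∪ M ∪ B)
  rw [Finset.card_union_of_disjoint hAMB, Finset.card_union_of_disjoint hAM] at this
  omega

open Classical in
/-- In a connected triangle-free cubic graph, a pair of vertices that are far apart relative to the number of
vertices forces bridges. -/
lemma two_mul_dist_add_four_le_card_add_ncard_isBridge (hc : G.Connected) (hr : G.IsRegularOfDegree 3)
    (hg : 4 ≤ G.egirth) {u v : V} (huv : 5 ≤ G.dist u v) :
    2 * G.dist u v + 4 ≤ Fintype.card V + 2 * {e : Sym2 V | G.IsBridge e}.ncard := by
  set I := Finset.Icc 3 (G.dist u v - 3)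
  set L : ℕ → Finset V := fun i => Finset.univ.filter fun w => G.dist u w = i with hL
  have hsum : ∑ i ∈ I, (L i).card + 14 ≤ Fintype.card V := sum_card_levels_add_le hc hr hg huv
  set J := I.filter fun i => (L i).card = 1
  have hlev : 2 * I.card ≤ ∑ i ∈ I, (L i).card + J.card := by
    rw [Finset.card_filter, ← Finset.sum_add_distrib, mul_comm, ← smul_eq_mul]
    refine Finset.card_nsmul_le_sum _ _ _ fun i hi => ?_
    obtain ⟨w, hw⟩ := hc.exists_dist_eq_of_le (i := i) (u := u) (v := v)
      (by have := Finset.mem_Icc.1 hi; omega)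
    have : 0 < (L i).card := Finset.card_pos.2 ⟨w, by simpa [hL] using hw⟩
    split_ifs <;> omega
  have hJ : J.card ≤ (J.biUnion L).card := by
    rw [Finset.card_biUnion]
    · rw [Finset.sum_congr rfl fun i hi => (Finset.mem_filter.1 hi).2]
      simp [J]
    · intro i _ k _ hik
      refine Finset.disjoint_left.2 fun w hw hw' => ?_
      simp only [hL, Finset.mem_filter_univ] at hw hw'
      exact hik (hw.symm.trans hw')
  have hX := card_le_two_mul_ncard_isBridge (G := G) (X := J.biUnion L) <| by
    intro x hx
    obtain ⟨i, hiJ, hxi⟩ := Finset.mem_biUnion.1 hx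
    obtain ⟨hiI, hi1⟩ := Finset.mem_filter.1 hiJ
    obtain ⟨h3, hd⟩ := Finset.mem_Icc.1 hiI
    have hxi' : G.dist u x = i := by simpa [hL] using hxi
    refine exists_isBridge_of_dist_unique (u := u) (z := v) hc hr (by omega) (by omega)
      fun y hy => ?_
    exact Finset.card_le_one.1 hi1.le y (by simpa [hL] using hy.trans hxi') x hxi
  have hI : I.card = G.dist u v - 5 := by
    rw [Nat.card_Icc]
    omega
  omega

end SimpleGraph

theorem cage_three_four_bridges (d q j : ℕ) (hd : 5 ≤ d) (hj : j ≤ 3)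
    (hdecomp : d = 5 + 4 * q + j)
    {V : Type*} [Fintype V] (G : SimpleGraph V) (hG : IsKGDGraph 3 4 d G)
    (hcard : Fintype.card V = 14 + 2 * j + 6 * q) :
    q ≤ {e : Sym2 V | G.IsBridge e}.ncard := by
  classical
  obtain ⟨hreg, hgirth, hdiam⟩ := hG
  have : Nonempty V := Fintype.card_pos_iff.1 (by omega)
  have hne : G.ediam ≠ ⊤ := by simp [hdiam]
  have hc := G.connected_of_ediam_ne_top hne
  obtain ⟨u, v, huv⟩ := G.exists_edist_eq_ediam_of_ne_top hne
  have huv : G.dist u v = d := by rw [SimpleGraph.dist, huv, hdiam, ENat.toNat_natCast]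
  have hr : G.IsRegularOfDegree 3 := fun w => by
    rw [← G.card_neighborFinset_eq_degree, ← hreg w, Set.ncard_eq_toFinset_card']
    rfl
  have := SimpleGraph.two_mul_dist_add_four_le_card_add_ncard_isBridge hc hr
    (by rw [hgirth]; rfl) (u := u) (v := v) (by omega)
  omega
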